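/- Fix integers n, s, d, m ≥ 1, K ≥ 1, an index r ∈ {1,…,m}, and an index i ∈ {1,…,n}. Let σ : ℝ → ℝ be bijective and let, for each edge type t ∈ {1,…,m}, N_t ∈ ℝ^{n×n} be invertible; define F_t : ℝ^{(s+m)×n} → ℝ^{(s+m)×n} by F_t(U) = σ.(U · N_t). Let o_{i,1},…,o_{i,m} ∈ ℝ^s, X ∈ ℝ^{s×d}, b ∈ ℝ^d, and α ∈ ℝ be given. Then there exist initial matrices U^{(0)}_1,…,U^{(0)}_m ∈ ℝ^{(s+m)×n} such that, letting u_{i,t} ∈ ℝ^{s+m} denote the i-th column of the K-fold iterate F_t^K(U^{(0)}_t), each u_{i,t} equals the concatenation of o_{i,t} with the t-th standard basis vector e_t of ℝ^m; consequently, with N ∈ ℝ^{(s+m)×d} equal to X stacked on the m×d zero matrix and λ_p(M) = exp(M·tanh(M·δ_{rp})) / ∑_{q=1}^m exp(M·tanh(M·δ_{rq})), the vector v(M) = b + α · N^T (∑_{p=1}^m λ_p(M) · u_{i,p}) converges to b + α · X^T o_{i,r} as M → ∞. -/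

import Mathlib

open Real Matrix Filter

/-- Right multiplication by an invertible matrix followed by a surjective entrywise map is
surjective on matrices. -/
lemma surjective_mul_right_map {l n R : Type*} [Fintype n] [DecidableEq n] [CommRing R]
    {σ : R → R} (hσ : Function.Surjective σ) {A : Matrix n n R} (hA : IsUnit A) :
    Function.Surjective fun U : Matrix l n R => (U * A).map σ := by
  intro V
  refine ⟨V.map (Function.surjInv hσ) * A⁻¹, ?_⟩
  ext a j
  simp [Matrix.mul_assoc, Matrix.nonsing_inv_mul A ((Matrix.isUnit_iff_isUnit_det A).1 hA),
    Function.surjInv_eq hσ]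

/-- If one score dominates all the others in the limit, then the softmax of the scores converges
to the indicator of that score. -/
lemma tendsto_softmax_of_tendsto_sub_atTop {β ι : Type*} [Fintype ι] [DecidableEq ι]
    {l : Filter β} {f : β → ι → ℝ} {r : ι}
    (hf : ∀ p, r ≠ p → Tendsto (fun x => f x r - f x p) l atTop) (p : ι) :
    Tendsto (fun x => Real.exp (f x p) / ∑ q, Real.exp (f x q)) l
      (nhds (if r = p then 1 else 0)) := by
  have key : ∀ q, Tendsto (fun x => Real.exp (f x q - f x r)) l
      (nhds (if r = q then 1 else 0)) := by
    intro q
    split_ifs with h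
    · simpa [h] using tendsto_const_nhds
    · refine Real.tendsto_exp_atBot.comp ?_
      simpa [Function.comp_def] using tendsto_neg_atTop_atBot.comp (hf q h)
  have hsum : Tendsto (fun x => ∑ q, Real.exp (f x q - f x r)) l (nhds 1) := by
    simpa using tendsto_finsetSum Finset.univ fun q _ => key q
  have h := (key p).div hsum one_ne_zero
  rw [div_one] at h
  refine h.congr fun x => ?_
  simp only [Pi.div_apply, Real.exp_sub, ← Finset.sum_div]
  exact div_div_div_cancel_right₀ (Real.exp_ne_zero _) _ _

lemma tendsto_mul_tanh_atTop : Tendsto (fun x : ℝ => x * Real.tanh x) atTop atTop := by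
  have h1 : 0 < Real.tanh 1 := by
    rw [Real.tanh_eq_sinh_div_cosh]
    exact div_pos (Real.sinh_pos_iff.2 one_pos) (Real.cosh_pos 1)
  refine tendsto_atTop_mono' _ ?_ (tendsto_id.atTop_mul_const h1)
  filter_upwards [eventually_ge_atTop 1] with x hx
  have h2 : Real.tanh 1 ≤ Real.tanh x := by
    rw [Real.tanh_eq_sinh_div_cosh, Real.tanh_eq_sinh_div_cosh,
      div_le_div_iff₀ (Real.cosh_pos 1) (Real.cosh_pos x)]
    have h3 : 0 ≤ Real.sinh (x - 1) := Real.sinh_nonneg_iff.2 (sub_nonneg.2 hx)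
    rw [Real.sinh_sub] at h3
    linarith
  exact mul_le_mul_of_nonneg_left h2 (zero_le_one.trans hx)

/-- A matrix whose bottom block is zero only sees the top part of a vector. -/
lemma transpose_append_zero_mulVec {s m : ℕ} {κ R : Type*} [CommRing R]
    (X : Matrix (Fin s) κ R) (v : Fin s → R) (w : Fin m → R) :
    (Matrix.of (Fin.append (fun a j => X a j) (fun (_ : Fin m) _ => (0 : R))))ᵀ *ᵥ
      Fin.append v w = Xᵀ *ᵥ v := by
  ext j
  simp [Matrix.mulVec, dotProduct, Fin.sum_univ_add]

/-- Theorem 1 of the GATNE paper combined with its 'Effects of Aggregation'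
discussion: even when the edge embeddings `u_{i,t}` of node `i` on each edge
type `t` are produced by `K` levels of aggregation
`U⁽ᵏ⁾ = σ.(U⁽ᵏ⁻¹⁾ * N_t)` (with invertible neighborhood matrices `N_t` and
bijective entrywise activation `σ`), there exist initial matrices
`U⁽⁰⁾_t` making each `u_{i,t}` the concatenation of `o_{i,t}` with the one-hot
indicator `e_t`; consequently the attention-based GATNE-T embedding
`v(M) = b + α • Nᵀ (∑_p λ_p(M) • u_{i,p})` converges to the MNE embedding
`b + α • Xᵀ o_{i,r}` as `M → ∞`. -/
theorem gatne_with_aggregation_approximates_mne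
    (n s d m K : ℕ) (hn : 1 ≤ n) (hs : 1 ≤ s) (hd : 1 ≤ d) (hm : 1 ≤ m)
    (hK : 1 ≤ K) (r : Fin m) (i : Fin n)
    (σ : ℝ → ℝ) (hσ : Function.Bijective σ)
    (Nt : Fin m → Matrix (Fin n) (Fin n) ℝ) (hNt : ∀ t, IsUnit (Nt t))
    (o : Fin m → Fin s → ℝ) (X : Matrix (Fin s) (Fin d) ℝ)
    (b : Fin d → ℝ) (α : ℝ) :
    let F : Fin m → Matrix (Fin (s + m)) (Fin n) ℝ → Matrix (Fin (s + m)) (Fin n) ℝ :=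
      fun t U => (U * Nt t).map σ
    let N : Matrix (Fin (s + m)) (Fin d) ℝ :=
      Matrix.of (Fin.append (fun a j => X a j) (fun _ _ => (0 : ℝ)))
    let lam : ℝ → Fin m → ℝ := fun M p =>
      Real.exp (M * Real.tanh (M * (if r = p then (1 : ℝ) else 0))) /
        ∑ q : Fin m, Real.exp (M * Real.tanh (M * (if r = q then (1 : ℝ) else 0)))
    ∃ U₀ : Fin m → Matrix (Fin (s + m)) (Fin n) ℝ,
      (∀ t : Fin m,
          (fun row : Fin (s + m) => (F t)^[K] (U₀ t) row i)
            = Fin.append (o t) (fun k : Fin m => if t = k then (1 : ℝ) else 0)) ∧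
      Tendsto
        (fun M : ℝ => b + α • (Nᵀ *ᵥ
          ∑ p : Fin m, lam M p • (fun row : Fin (s + m) => (F p)^[K] (U₀ p) row i)))
        atTop (nhds (b + α • (Xᵀ *ᵥ o r))) := by
  intro F N lam
  have hiter : ∀ t, ∃ U : Matrix (Fin (s + m)) (Fin n) ℝ, (F t)^[K] U =
      Matrix.of fun row _ => Fin.append (o t) (fun k : Fin m => if t = k then (1 : ℝ) else 0) row :=
    fun t => (surjective_mul_right_map hσ.surjective (hNt t)).iterate K _
  choose U₀ hU₀ using hiter
  have hcol : ∀ t : Fin m, (fun row : Fin (s + m) => (F t)^[K] (U₀ t) row i)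
      = Fin.append (o t) (fun k : Fin m => if t = k then (1 : ℝ) else 0) := by
    intro t
    rw [hU₀ t]
    rfl
  refine ⟨U₀, hcol, ?_⟩
  have hlam : ∀ p, Tendsto (fun M => lam M p) atTop (nhds (if r = p then 1 else 0)) :=
    tendsto_softmax_of_tendsto_sub_atTop
      (f := fun M p => M * Real.tanh (M * (if r = p then (1 : ℝ) else 0))) fun p hp => by
        simpa [hp] using tendsto_mul_tanh_atTop
  simp only [hcol]
  have hsum := tendsto_finsetSum Finset.univ fun p _ => (hlam p).smul_const
    (Fin.append (o p) (fun k : Fin m => if p = k then (1 : ℝ) else 0))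
  simp only [ite_smul, one_smul, zero_smul, Finset.sum_ite_eq, Finset.mem_univ, if_true] at hsum
  have hcont : Continuous fun v : Fin (s + m) → ℝ => b + α • (Nᵀ *ᵥ v) := by fun_prop
  have h := (hcont.tendsto _).comp hsum
  rwa [transpose_append_zero_mulVec] at h
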